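/- Fix nonempty finite sets Ω and A, a finite message set M with |M| > max{|Ω|, |A|}, and an interior prior μ₀ on Ω. Then there is a generic set of environments such that for every environment (u_S, u_R) in that set: commitment is valuable if and only if committed Sender values randomization. -/

import Mathlib

open MeasureTheory

namespace KL

/-- `f` is a probability distribution on the finite type `X`. -/
def IsDist {X : Type} [Fintype X] (f : X → ℝ) : Prop :=
  (∀ x, 0 ≤ f x) ∧ ∑ x, f x = 1

/-- `μ₀` is an interior prior on `Ω`. -/
def IsPrior {Ω : Type} [Fintype Ω] (μ₀ : Ω → ℝ) : Prop :=
  (∀ ω, 0 < μ₀ ω) ∧ ∑ ω, μ₀ ω = 1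

variable {Ω A M : Type} [Fintype Ω] [Fintype A] [Fintype M]

/-- A messaging strategy: a distribution over messages in each state. -/
def IsMsg (σ : Ω → M → ℝ) : Prop := ∀ ω, IsDist (σ ω)

/-- An action strategy: a distribution over actions after each message. -/
def IsAct (ρ : M → A → ℝ) : Prop := ∀ m, IsDist (ρ m)

/-- Expected payoff of a profile `(σ, ρ)` for utility `u`. -/
def U (μ₀ : Ω → ℝ) (u : A × Ω → ℝ) (σ : Ω → M → ℝ) (ρ : M → A → ℝ) : ℝ :=
  ∑ ω, ∑ m, ∑ a, μ₀ ω * σ ω m * ρ m a * u (a, ω)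

/-- Sender best response. -/
def SBR (μ₀ : Ω → ℝ) (uS : A × Ω → ℝ) (σ : Ω → M → ℝ) (ρ : M → A → ℝ) : Prop :=
  ∀ σ' : Ω → M → ℝ, IsMsg σ' → U μ₀ uS σ' ρ ≤ U μ₀ uS σ ρ

/-- Receiver best response. -/
def RBR (μ₀ : Ω → ℝ) (uR : A × Ω → ℝ) (σ : Ω → M → ℝ) (ρ : M → A → ℝ) : Prop :=
  ∀ ρ' : M → A → ℝ, IsAct ρ' → U μ₀ uR σ ρ' ≤ U μ₀ uR σ ρ

/-- A cheap-talk equilibrium: a profile of valid strategies that is S-BR and R-BR. -/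
def CTEq (μ₀ : Ω → ℝ) (uS uR : A × Ω → ℝ) (σ : Ω → M → ℝ) (ρ : M → A → ℝ) : Prop :=
  IsMsg σ ∧ IsAct ρ ∧ SBR μ₀ uS σ ρ ∧ RBR μ₀ uR σ ρ

/-- A persuasion profile: a profile of valid strategies that is R-BR. -/
def PersProfile (μ₀ : Ω → ℝ) (uR : A × Ω → ℝ) (σ : Ω → M → ℝ) (ρ : M → A → ℝ) : Prop :=
  IsMsg σ ∧ IsAct ρ ∧ RBR μ₀ uR σ ρ

/-- The cheap-talk payoff: the maximal Sender payoff over cheap-talk equilibria. -/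
noncomputable def ctPayoff (μ₀ : Ω → ℝ) (uS uR : A × Ω → ℝ) : ℝ :=
  sSup {x | ∃ (σ : Ω → M → ℝ) (ρ : M → A → ℝ), CTEq μ₀ uS uR σ ρ ∧ x = U μ₀ uS σ ρ}

/-- The (Bayesian) persuasion payoff: the maximal Sender payoff over persuasion profiles. -/
noncomputable def persPayoff (μ₀ : Ω → ℝ) (uS uR : A × Ω → ℝ) : ℝ :=
  sSup {x | ∃ (σ : Ω → M → ℝ) (ρ : M → A → ℝ), PersProfile μ₀ uR σ ρ ∧ x = U μ₀ uS σ ρ}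

/-- A messaging strategy is partitional if it is deterministic in every state. -/
def Partitional (σ : Ω → M → ℝ) : Prop := ∀ ω, ∃ m, σ ω m = 1

/-- The partitional persuasion payoff. -/
noncomputable def partPersPayoff (μ₀ : Ω → ℝ) (uS uR : A × Ω → ℝ) : ℝ :=
  sSup {x | ∃ (σ : Ω → M → ℝ) (ρ : M → A → ℝ),
    Partitional σ ∧ PersProfile μ₀ uR σ ρ ∧ x = U μ₀ uS σ ρ}

/-- The partitional cheap-talk payoff. -/
noncomputable def partCtPayoff (μ₀ : Ω → ℝ) (uS uR : A × Ω → ℝ) : ℝ :=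
  sSup {x | ∃ (σ : Ω → M → ℝ) (ρ : M → A → ℝ),
    Partitional σ ∧ CTEq μ₀ uS uR σ ρ ∧ x = U μ₀ uS σ ρ}

/-- A message is on-path if it is sent with positive probability in some state. -/
def OnPath (σ : Ω → M → ℝ) (m : M) : Prop := ∃ ω, 0 < σ ω m

/-- A pure action strategy: degenerate after every message. -/
def IsPureAct (ρ : M → A → ℝ) : Prop := ∀ m, ∃ a, ρ m a = 1

/-- A pure-on-path action strategy: degenerate after every on-path message. -/
def PureOnPath (σ : Ω → M → ℝ) (ρ : M → A → ℝ) : Prop :=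
  ∀ m, OnPath σ m → ∃ a, ρ m a = 1

/-- The posterior belief induced by message `m`. -/
noncomputable def post (μ₀ : Ω → ℝ) (σ : Ω → M → ℝ) (m : M) (ω : Ω) : ℝ :=
  μ₀ ω * σ ω m / ∑ ω', μ₀ ω' * σ ω' m

/-- The cube of environments `[0,1]^(2|A||Ω|)`. -/
def EnvCube (Ω A : Type) : Set ((A × Ω → ℝ) × (A × Ω → ℝ)) :=
  {e | (∀ p, e.1 p ∈ Set.Icc (0 : ℝ) 1) ∧ ∀ p, e.2 p ∈ Set.Icc (0 : ℝ) 1}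

/-- The cube of transparent environments `[0,1]^(|A|(|Ω|+1))`, points `(v, u_R)`. -/
def TransCube (Ω A : Type) : Set ((A → ℝ) × (A × Ω → ℝ)) :=
  {e | (∀ a, e.1 a ∈ Set.Icc (0 : ℝ) 1) ∧ ∀ p, e.2 p ∈ Set.Icc (0 : ℝ) 1}

open Classical in
/-- The expanded-indifference matrix `T^i`: rows `u_S(a_j,·) − u_S(a_i,·)` for `j ≠ i`,
rows `u_R(a_j,·) − u_R(a_i,·)` for `j ≠ i`, and the rows of the identity matrix. -/
noncomputable def TMat (uS uR : A × Ω → ℝ) (i : A) :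
    Matrix (({j : A // j ≠ i} ⊕ {j : A // j ≠ i}) ⊕ Ω) Ω ℝ :=
  Matrix.of fun r ω =>
    match r with
    | Sum.inl (Sum.inl j) => uS (j.1, ω) - uS (i, ω)
    | Sum.inl (Sum.inr j) => uR (j.1, ω) - uR (i, ω)
    | Sum.inr ω' => if ω' = ω then 1 else 0

/-- Scant indifferences: every row-submatrix of every expanded-indifference matrix has
full rank (rank equal to the minimum of the number of rows and the number of columns). -/
def ScantIndiff (uS uR : A × Ω → ℝ) : Prop :=
  ∀ i : A, ∀ s : Finset (({j : A // j ≠ i} ⊕ {j : A // j ≠ i}) ⊕ Ω),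
    ((TMat uS uR i).submatrix (fun r : {x // x ∈ s} => r.1) id).rank
      = min s.card (Fintype.card Ω)

open Classical in
/-- The set `Ω_a` of states in which `a` is an ideal action for Sender. -/
noncomputable def idealStates (uS : A × Ω → ℝ) (a : A) : Finset Ω :=
  Finset.univ.filter fun ω => ∀ b, uS (b, ω) ≤ uS (a, ω)

/-- Felicitous environment. -/
def Felicitous (μ₀ : Ω → ℝ) (uS uR : A × Ω → ℝ) : Prop :=
  ∀ a a' : A, 0 ≤ ∑ ω ∈ idealStates uS a, μ₀ ω * (uR (a, ω) - uR (a', ω))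

/-- Partitional-unique-response: for every nonempty subset of states, Receiver's
expected payoff has a unique maximizer. -/
def PUR (μ₀ : Ω → ℝ) (uR : A × Ω → ℝ) : Prop :=
  ∀ S : Finset Ω, S.Nonempty →
    ∃! a : A, ∀ b : A, ∑ ω ∈ S, μ₀ ω * uR (b, ω) ≤ ∑ ω ∈ S, μ₀ ω * uR (a, ω)

/-- Jointly-inclusive environment: each action is the unique ideal action of both
players in some state. -/
def JointlyInclusive (uS uR : A × Ω → ℝ) : Prop :=
  ∀ a : A, ∃ ω : Ω,
    (∀ b, b ≠ a → uS (b, ω) < uS (a, ω)) ∧ ∀ b, b ≠ a → uR (b, ω) < uR (a, ω)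

section Helpers

open Filter Topology

open Classical in
lemma isDist_single {X : Type} [Fintype X] (x : X) : IsDist (Pi.single x (1 : ℝ) : X → ℝ) := by
  constructor
  · intro y
    by_cases h : y = x
    · subst h; simp
    · simp [h]
  · simp

lemma isDist_eq_one {X : Type} [Fintype X] {p : X → ℝ} (hp : IsDist p) (x : X)
    (h : ∀ y, y ≠ x → p y = 0) : p x = 1 := by
  rw [← hp.2]
  exact (Finset.sum_eq_single x (fun y _ hy => h y hy) (by simp)).symm

lemma isDist_eq_zero {X : Type} [Fintype X] {p : X → ℝ} (hp : IsDist p) {x y : X}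
    (h : p x = 1) (hy : y ≠ x) : p y = 0 := by
  classical
  have h1 := hp.2
  rw [← Finset.add_sum_erase _ _ (Finset.mem_univ x), h] at h1
  have h2 : ∑ z ∈ Finset.univ.erase x, p z = 0 := by linarith
  exact (Finset.sum_eq_zero_iff_of_nonneg (fun z _ => hp.1 z)).1 h2 y (by simp [hy])

lemma isDist_exists_pos {X : Type} [Fintype X] {p : X → ℝ} (hp : IsDist p) : ∃ x, 0 < p x := by
  by_contra h
  push Not at h
  have : ∑ x, p x ≤ 0 := Finset.sum_nonpos (fun x _ => h x)
  rw [hp.2] at this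
  linarith

/-- Maximisation of a linear functional over a product of simplices. -/
lemma max_iff {I J : Type} [Fintype I] [Fintype J] (f p : I → J → ℝ) (hp : ∀ i, IsDist (p i)) :
    (∀ p' : I → J → ℝ, (∀ i, IsDist (p' i)) →
      ∑ i, ∑ j, p' i j * f i j ≤ ∑ i, ∑ j, p i j * f i j) ↔
    ∀ i j, 0 < p i j → ∀ k, f i k ≤ f i j := by
  classical
  constructor
  · intro h i j hij k
    have hJ : Nonempty J := ⟨j⟩
    obtain ⟨c, hc⟩ := Finite.exists_max (f i)
    have h1 := h (Function.update p i (Pi.single c 1)) (by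
      intro i'
      by_cases hi : i' = i
      · subst hi; simpa using isDist_single c
      · simpa [hi] using hp i')
    rw [← Finset.add_sum_erase _ _ (Finset.mem_univ i),
      ← Finset.add_sum_erase (a := i) Finset.univ _ (Finset.mem_univ i)] at h1
    have h2 : ∑ x ∈ Finset.univ.erase i, ∑ j, Function.update p i (Pi.single c 1) x j * f x j
        = ∑ x ∈ Finset.univ.erase i, ∑ j, p x j * f x j := by
      refine Finset.sum_congr rfl (fun x hx => ?_)
      rw [Function.update_of_ne (Finset.ne_of_mem_erase hx)]
    rw [h2] at h1
    have h3 : ∑ j, Function.update p i (Pi.single c 1) i j * f i j = f i c := by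
      simp [Pi.single_apply]
    rw [h3] at h1
    have h4 : ∑ j, p i j * (f i c - f i j) = f i c - ∑ j, p i j * f i j := by
      simp only [mul_sub, Finset.sum_sub_distrib, ← Finset.sum_mul, (hp i).2, one_mul]
    have h5 : ∀ j ∈ Finset.univ, 0 ≤ p i j * (f i c - f i j) := fun j _ =>
      mul_nonneg ((hp i).1 j) (sub_nonneg.2 (hc j))
    have h6 := Finset.single_le_sum h5 (Finset.mem_univ j)
    have h7 : p i j * (f i c - f i j) ≤ 0 := by linarith
    have h8 := hc k
    nlinarith
  · intro h p' hp'
    refine Finset.sum_le_sum (fun i _ => ?_)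
    obtain ⟨j0, hj0⟩ := isDist_exists_pos (hp i)
    have e1 : ∑ j, p i j * f i j = f i j0 := by
      have : ∀ j ∈ Finset.univ, p i j * f i j = p i j * f i j0 := by
        intro j _
        rcases ((hp i).1 j).eq_or_lt with h0 | h0
        · rw [← h0]; simp
        · rw [le_antisymm (h i j0 hj0 j) (h i j h0 j0)]
      rw [Finset.sum_congr rfl this, ← Finset.sum_mul, (hp i).2, one_mul]
    have e2 : ∑ j, p' i j * f i j ≤ ∑ j, p' i j * f i j0 :=
      Finset.sum_le_sum (fun j _ => mul_le_mul_of_nonneg_left (h i j0 hj0 j) ((hp' i).1 j))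
    rw [← Finset.sum_mul, (hp' i).2, one_mul] at e2
    linarith

lemma U_eq_R (μ₀ : Ω → ℝ) (u : A × Ω → ℝ) (σ : Ω → M → ℝ) (ρ : M → A → ℝ) :
    U μ₀ u σ ρ = ∑ m, ∑ a, ρ m a * ∑ ω, μ₀ ω * σ ω m * u (a, ω) := by
  unfold U
  rw [Finset.sum_comm]
  refine Finset.sum_congr rfl (fun m _ => ?_)
  rw [Finset.sum_comm]
  refine Finset.sum_congr rfl (fun a _ => ?_)
  rw [Finset.mul_sum]
  refine Finset.sum_congr rfl (fun ω _ => ?_)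
  ring

lemma U_eq_S (μ₀ : Ω → ℝ) (u : A × Ω → ℝ) (σ : Ω → M → ℝ) (ρ : M → A → ℝ) :
    U μ₀ u σ ρ = ∑ ω, ∑ m, σ ω m * (μ₀ ω * ∑ a, ρ m a * u (a, ω)) := by
  unfold U
  refine Finset.sum_congr rfl (fun ω _ => Finset.sum_congr rfl (fun m _ => ?_))
  rw [Finset.mul_sum, Finset.mul_sum]
  refine Finset.sum_congr rfl (fun a _ => ?_)
  ring

lemma RBR_iff (μ₀ : Ω → ℝ) (u : A × Ω → ℝ) (σ : Ω → M → ℝ) (ρ : M → A → ℝ) (hρ : IsAct ρ) :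
    RBR μ₀ u σ ρ ↔ ∀ m a, 0 < ρ m a → ∀ c,
      ∑ ω, μ₀ ω * σ ω m * u (c, ω) ≤ ∑ ω, μ₀ ω * σ ω m * u (a, ω) := by
  rw [← max_iff (fun m a => ∑ ω, μ₀ ω * σ ω m * u (a, ω)) ρ hρ]
  unfold RBR
  simp only [U_eq_R]
  rfl

lemma SBR_iff (μ₀ : Ω → ℝ) (hμ : IsPrior μ₀) (u : A × Ω → ℝ) (σ : Ω → M → ℝ) (ρ : M → A → ℝ)
    (hσ : IsMsg σ) :
    SBR μ₀ u σ ρ ↔ ∀ ω m, 0 < σ ω m → ∀ k,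
      ∑ a, ρ k a * u (a, ω) ≤ ∑ a, ρ m a * u (a, ω) := by
  have := max_iff (fun ω m => μ₀ ω * ∑ a, ρ m a * u (a, ω)) σ hσ
  simp only [mul_le_mul_iff_of_pos_left (hμ.1 _)] at this
  rw [← this]
  unfold SBR
  simp only [U_eq_S]
  rfl

/-- Obedience slack of a direct mechanism. -/
noncomputable def Ob (μ₀ : Ω → ℝ) (uR : A × Ω → ℝ) (x : Ω → A → ℝ) (a c : A) : ℝ :=
  ∑ ω, μ₀ ω * x ω a * (uR (a, ω) - uR (c, ω))

/-- Sender payoff of a direct mechanism. -/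
noncomputable def Vd (μ₀ : Ω → ℝ) (uS : A × Ω → ℝ) (x : Ω → A → ℝ) : ℝ :=
  ∑ ω, ∑ a, μ₀ ω * x ω a * uS (a, ω)

/-- The direct mechanism of a profile. -/
noncomputable def dir (σ : Ω → M → ℝ) (ρ : M → A → ℝ) : Ω → A → ℝ :=
  fun ω a => ∑ m, σ ω m * ρ m a

lemma dir_isMsg {σ : Ω → M → ℝ} {ρ : M → A → ℝ} (hσ : IsMsg σ) (hρ : IsAct ρ) :
    IsMsg (dir σ ρ) := by
  intro ω
  refine ⟨fun a => Finset.sum_nonneg (fun m _ => mul_nonneg ((hσ ω).1 m) ((hρ m).1 a)), ?_⟩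
  unfold dir
  rw [Finset.sum_comm]
  simp only [← Finset.mul_sum, (hρ _).2, mul_one, (hσ ω).2]

lemma dir_V (μ₀ : Ω → ℝ) (uS : A × Ω → ℝ) (σ : Ω → M → ℝ) (ρ : M → A → ℝ) :
    Vd μ₀ uS (dir σ ρ) = U μ₀ uS σ ρ := by
  unfold Vd dir U
  refine Finset.sum_congr rfl (fun ω _ => ?_)
  rw [Finset.sum_comm]
  refine Finset.sum_congr rfl (fun a _ => ?_)
  rw [Finset.mul_sum, Finset.sum_mul]
  refine Finset.sum_congr rfl (fun m _ => ?_)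
  ring

lemma dir_Ob (μ₀ : Ω → ℝ) (uR : A × Ω → ℝ) (σ : Ω → M → ℝ) (ρ : M → A → ℝ) (a c : A) :
    Ob μ₀ uR (dir σ ρ) a c = ∑ m, ρ m a * (∑ ω, μ₀ ω * σ ω m * uR (a, ω)
      - ∑ ω, μ₀ ω * σ ω m * uR (c, ω)) := by
  unfold Ob dir
  simp only [← Finset.sum_sub_distrib, Finset.mul_sum, Finset.sum_mul]
  rw [Finset.sum_comm]
  refine Finset.sum_congr rfl (fun m _ => Finset.sum_congr rfl (fun a _ => ?_))
  ring

lemma dir_term_nonneg {μ₀ : Ω → ℝ} {uR : A × Ω → ℝ} {σ : Ω → M → ℝ} {ρ : M → A → ℝ}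
    (h : PersProfile μ₀ uR σ ρ) (a c : A) (m : M) :
    0 ≤ ρ m a * (∑ ω, μ₀ ω * σ ω m * uR (a, ω) - ∑ ω, μ₀ ω * σ ω m * uR (c, ω)) := by
  rcases ((h.2.1 m).1 a).eq_or_lt with h0 | h0
  · rw [← h0]; simp
  · exact mul_nonneg h0.le (sub_nonneg.2 ((RBR_iff _ _ _ _ h.2.1).1 h.2.2 m a h0 c))

lemma dir_Ob_nonneg {μ₀ : Ω → ℝ} {uR : A × Ω → ℝ} {σ : Ω → M → ℝ} {ρ : M → A → ℝ}
    (h : PersProfile μ₀ uR σ ρ) (a c : A) : 0 ≤ Ob μ₀ uR (dir σ ρ) a c := by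
  rw [dir_Ob]
  exact Finset.sum_nonneg (fun m _ => dir_term_nonneg h a c m)

open Classical in
/-- Realising a direct obedient mechanism by a profile. -/
lemma from_dir (μ₀ : Ω → ℝ) (uS uR : A × Ω → ℝ) [Nonempty A] (i : A → M)
    (hi : Function.Injective i) (x : Ω → A → ℝ) (hx : IsMsg x)
    (hO : ∀ a c, 0 ≤ Ob μ₀ uR x a c) :
    ∃ (σ : Ω → M → ℝ) (ρ : M → A → ℝ), PersProfile μ₀ uR σ ρ ∧ U μ₀ uS σ ρ = Vd μ₀ uS x ∧
      ((∀ ω, ∃ a, x ω a = 1) → Partitional σ) := by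
  set g : M → A := Function.invFun i with hg
  have hgi : ∀ a, g (i a) = a := Function.leftInverse_invFun hi
  set σ : Ω → M → ℝ := fun ω m => ∑ a, if i a = m then x ω a else 0 with hσ
  set ρ : M → A → ℝ := fun m => Pi.single (g m) 1 with hρ
  have hσi : ∀ ω a, σ ω (i a) = x ω a := by
    intro ω a
    simp [hσ, hi.eq_iff]
  have hσn : ∀ ω m, (∀ a, i a ≠ m) → σ ω m = 0 := by
    intro ω m h
    simp [hσ, h]
  have hsum : ∀ ω (F : M → ℝ), ∑ m, σ ω m * F m = ∑ a, x ω a * F (i a) := by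
    intro ω F
    simp only [hσ, Finset.sum_mul]
    rw [Finset.sum_comm]
    refine Finset.sum_congr rfl (fun a _ => ?_)
    simp
  have hσm : IsMsg σ := by
    intro ω
    refine ⟨fun m => Finset.sum_nonneg (fun a _ => ?_), ?_⟩
    · split_ifs
      · exact (hx ω).1 a
      · exact le_rfl
    · have := hsum ω (fun _ => 1)
      simpa [(hx ω).2] using this
  have hρa : IsAct ρ := fun m => isDist_single _
  refine ⟨σ, ρ, ⟨hσm, hρa, ?_⟩, ?_, ?_⟩
  · rw [RBR_iff _ _ _ _ hρa]
    intro m a hma c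
    have ha : a = g m := by
      by_contra hne
      simp [hρ, hne] at hma
    by_cases hm : ∃ b, i b = m
    · obtain ⟨b, rfl⟩ := hm
      rw [hgi] at ha
      subst ha
      simp only [hσi]
      have := hO a c
      unfold Ob at this
      simp only [mul_sub, Finset.sum_sub_distrib] at this
      linarith
    · push Not at hm
      simp [hσn _ _ hm]
  · rw [U_eq_S]
    unfold Vd
    refine Finset.sum_congr rfl (fun ω _ => ?_)
    rw [hsum]
    refine Finset.sum_congr rfl (fun a _ => ?_)
    simp [hρ, hgi, Pi.single_apply]
    ring
  · intro h ω
    obtain ⟨a, ha⟩ := h ω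
    exact ⟨i a, by rw [hσi, ha]⟩

lemma ev_aux {p q : ℝ} (hp : 0 ≤ p) (h : p = 0 → 0 ≤ q) :
    ∀ᶠ ε in 𝓝[>] (0 : ℝ), 0 ≤ p + ε * q := by
  rcases hp.eq_or_lt with h0 | h0
  · filter_upwards [self_mem_nhdsWithin] with ε hε
    rw [← h0]
    have := mul_nonneg (le_of_lt hε) (h h0.symm)
    linarith
  · have : Tendsto (fun ε : ℝ => p + ε * q) (𝓝[>] 0) (𝓝 (p + 0 * q)) := by
      apply Tendsto.mono_left _ nhdsWithin_le_nhds
      exact Continuous.tendsto (by fun_prop) 0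
    rw [zero_mul, add_zero] at this
    filter_upwards [this.eventually (lt_mem_nhds h0)] with ε hε
    exact hε.le

/-- First order condition at an optimal direct mechanism. -/
lemma perturb (μ₀ : Ω → ℝ) (uS uR : A × Ω → ℝ) (x d : Ω → A → ℝ) (hx : IsMsg x)
    (hO : ∀ a c, 0 ≤ Ob μ₀ uR x a c)
    (hopt : ∀ x' : Ω → A → ℝ, IsMsg x' → (∀ a c, 0 ≤ Ob μ₀ uR x' a c) →
      Vd μ₀ uS x' ≤ Vd μ₀ uS x)
    (hd : ∀ ω, ∑ a, d ω a = 0) (hd0 : ∀ ω a, x ω a = 0 → 0 ≤ d ω a)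
    (hdO : ∀ a c, Ob μ₀ uR x a c = 0 → 0 ≤ Ob μ₀ uR d a c) : Vd μ₀ uS d ≤ 0 := by
  have e1 : ∀ᶠ ε in 𝓝[>] (0 : ℝ), ∀ ω a, 0 ≤ x ω a + ε * d ω a :=
    eventually_all.2 fun ω => eventually_all.2 fun a => ev_aux ((hx ω).1 a) (hd0 ω a)
  have e2 : ∀ᶠ ε in 𝓝[>] (0 : ℝ), ∀ a c, 0 ≤ Ob μ₀ uR x a c + ε * Ob μ₀ uR d a c :=
    eventually_all.2 fun a => eventually_all.2 fun c => ev_aux (hO a c) (hdO a c)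
  obtain ⟨ε, ⟨h1, h2⟩, h3⟩ := ((e1.and e2).and self_mem_nhdsWithin).exists
  have hε : (0 : ℝ) < ε := h3
  have := hopt (fun ω a => x ω a + ε * d ω a) (by
      intro ω
      refine ⟨h1 ω, ?_⟩
      rw [Finset.sum_add_distrib, ← Finset.mul_sum, hd, (hx ω).2]; simp) (by
      intro a c
      have h := h2 a c
      convert h using 1
      unfold Ob
      rw [Finset.mul_sum, ← Finset.sum_add_distrib]
      refine Finset.sum_congr rfl (fun ω _ => ?_)
      ring)
  have hV : Vd μ₀ uS (fun ω a => x ω a + ε * d ω a) = Vd μ₀ uS x + ε * Vd μ₀ uS d := by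
    unfold Vd
    rw [Finset.mul_sum, ← Finset.sum_add_distrib]
    refine Finset.sum_congr rfl (fun ω _ => ?_)
    rw [Finset.mul_sum, ← Finset.sum_add_distrib]
    refine Finset.sum_congr rfl (fun a _ => ?_)
    ring
  rw [hV] at this
  by_contra hc
  push Not at hc
  have := mul_pos hε hc
  linarith

/-- The set of environments failing the independence condition. -/
def Bad (a b : A) (B : Finset A) (S : Finset Ω) : Set ((A × Ω → ℝ) × (A × Ω → ℝ)) :=
  {e | ∃ (l : A → ℝ) (y : Ω → ℝ), ‖y‖ = 1 ∧ (∀ ω, ω ∉ S → y ω = 0) ∧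
    (∀ c ∈ B, ∑ ω, y ω * (e.2 (c, ω) - e.2 (a, ω)) = 0) ∧
    ∀ ω ∈ S, e.1 (b, ω) - e.1 (a, ω) = ∑ c ∈ B, l c * (e.2 (c, ω) - e.2 (a, ω))}

/-- Generic environments. -/
def Good (μ₀ : Ω → ℝ) (uS uR : A × Ω → ℝ) : Prop :=
  (∀ a b, a ≠ b → ∀ B S, (uS, uR) ∉ Bad a b B S) ∧
  (∀ a b, a ≠ b → ∀ ω, uS (a, ω) ≠ uS (b, ω)) ∧
  (∀ a b, a ≠ b → ∀ S : Finset Ω, S.Nonempty →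
    ∑ ω ∈ S, μ₀ ω * (uR (a, ω) - uR (b, ω)) ≠ 0)

lemma exists_delta (a b : A) (B : Finset A) (S : Finset Ω) (uS uR : A × Ω → ℝ)
    (hbad : (uS, uR) ∉ Bad a b B S) (y : Ω → ℝ) (hy : y ≠ 0) (hyS : ∀ ω, ω ∉ S → y ω = 0)
    (hyB : ∀ c ∈ B, ∑ ω, y ω * (uR (c, ω) - uR (a, ω)) = 0) :
    ∃ δ : Ω → ℝ, (∀ ω, ω ∉ S → δ ω = 0) ∧
      (∀ c ∈ B, ∑ ω, δ ω * (uR (c, ω) - uR (a, ω)) = 0) ∧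
      ∑ ω, δ ω * (uS (b, ω) - uS (a, ω)) ≠ 0 := by
  classical
  by_contra hcon
  push Not at hcon
  let F : (Ω → ℝ) → ((Ω → ℝ) →ₗ[ℝ] ℝ) := fun v =>
    ∑ ω ∈ S, (v ω) • (LinearMap.proj ω : (Ω → ℝ) →ₗ[ℝ] ℝ)
  have hF : ∀ v δ, F v δ = ∑ ω ∈ S, v ω * δ ω := by
    intro v δ
    simp [F, LinearMap.sum_apply]
  let L : {c // c ∈ B} → ((Ω → ℝ) →ₗ[ℝ] ℝ) := fun c => F (fun ω => uR (c.1, ω) - uR (a, ω))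
  let K : (Ω → ℝ) →ₗ[ℝ] ℝ := F (fun ω => uS (b, ω) - uS (a, ω))
  have hres : ∀ v δ : Ω → ℝ, ∑ ω, (if ω ∈ S then δ ω else 0) * v ω = F v δ := by
    intro v δ
    rw [hF]
    simp only [ite_mul, zero_mul, Finset.sum_ite_mem, Finset.univ_inter]
    exact Finset.sum_congr rfl (fun _ _ => mul_comm _ _)
  have hle : ⨅ c, LinearMap.ker (L c) ≤ LinearMap.ker K := by
    intro δ hδ
    simp only [Submodule.mem_iInf, LinearMap.mem_ker] at hδ ⊢
    have := hcon (fun ω => if ω ∈ S then δ ω else 0) (by intro ω h; simp [h]) (by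
      intro c hc
      rw [hres (fun ω => uR (c, ω) - uR (a, ω))]
      exact hδ ⟨c, hc⟩)
    rw [hres (fun ω => uS (b, ω) - uS (a, ω))] at this
    exact this
  have hspan := mem_span_of_iInf_ker_le_ker hle
  obtain ⟨l, hl⟩ := (Submodule.mem_span_range_iff_exists_fun ℝ).1 hspan
  apply hbad
  refine ⟨fun c => if h : c ∈ B then l ⟨c, h⟩ else 0, ‖y‖⁻¹ • y, ?_, ?_, ?_, ?_⟩
  · rw [norm_smul, norm_inv, norm_norm, inv_mul_cancel₀ (norm_ne_zero_iff.2 hy)]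
  · intro ω h
    simp [hyS ω h]
  · intro c hc
    simp only [Pi.smul_apply, smul_eq_mul, mul_assoc, ← Finset.mul_sum]
    rw [hyB c hc, mul_zero]
  · intro ω hω
    have h1 := congrArg (fun f => f (Pi.single ω 1)) hl
    simp only [LinearMap.sum_apply, LinearMap.smul_apply, smul_eq_mul] at h1
    have h2 : ∀ v : Ω → ℝ, F v (Pi.single ω 1) = v ω := by
      intro v
      rw [hF]
      simp [Pi.single_apply, hω]
    simp only [L, K, h2] at h1
    rw [← h1, ← Finset.sum_coe_sort B]
    refine Finset.sum_congr rfl (fun c _ => ?_)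
    simp

/-- Optimal persuasion profiles are pure on path in good environments. -/
lemma pure_on_path (μ₀ : Ω → ℝ) (hμ : IsPrior μ₀) (uS uR : A × Ω → ℝ) (hG : Good μ₀ uS uR)
    (σ : Ω → M → ℝ) (ρ : M → A → ℝ) (h : PersProfile μ₀ uR σ ρ)
    (hopt : ∀ x' : Ω → A → ℝ, IsMsg x' → (∀ a c, 0 ≤ Ob μ₀ uR x' a c) →
      Vd μ₀ uS x' ≤ Vd μ₀ uS (dir σ ρ))
    (m : M) (ω₀ : Ω) (hm : 0 < σ ω₀ m) (a b : A) (ha : 0 < ρ m a) (hb : 0 < ρ m b) : a = b := by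
  classical
  by_contra hab
  set R : A → ℝ := fun c => ∑ ω, μ₀ ω * σ ω m * uR (c, ω) with hR
  have hbest := (RBR_iff _ _ _ _ h.2.1).1 h.2.2
  have hRab : R b = R a := le_antisymm (hbest m a ha b) (hbest m b hb a)
  set B : Finset A := Finset.univ.filter (fun c => R c = R a) with hB
  set S : Finset Ω := Finset.univ.filter (fun ω => 0 < σ ω m) with hS
  have hSn : ∀ ω, ω ∉ S → σ ω m = 0 := by
    intro ω hω
    simp only [hS, Finset.mem_filter, Finset.mem_univ, true_and, not_lt] at hω
    exact le_antisymm hω ((h.1 ω).1 m)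
  obtain ⟨δ, hδS, hδB, hδ⟩ := exists_delta a b B S uS uR (hG.1 a b hab B S)
    (fun ω => μ₀ ω * σ ω m)
    (by
      intro h0
      have := congrFun h0 ω₀
      have h2 := mul_pos (hμ.1 ω₀) hm
      simp only [Pi.zero_apply] at this
      linarith)
    (by intro ω hω; simp [hSn ω hω])
    (by
      intro c hc
      simp only [hB, Finset.mem_filter, Finset.mem_univ, true_and] at hc
      simp only [mul_sub, Finset.sum_sub_distrib]
      simp only [hR] at hc
      linarith)
  have key : ∀ δ : Ω → ℝ, (∀ ω, ω ∉ S → δ ω = 0) →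
      (∀ c ∈ B, ∑ ω, δ ω * (uR (c, ω) - uR (a, ω)) = 0) →
      ∑ ω, δ ω * (uS (b, ω) - uS (a, ω)) ≤ 0 := by
    intro δ hδS hδB
    set d : Ω → A → ℝ := fun ω c =>
      (δ ω / μ₀ ω) * ((if c = b then 1 else 0) - (if c = a then 1 else 0)) with hd
    have hμd : ∀ ω, μ₀ ω * (δ ω / μ₀ ω) = δ ω := fun ω => mul_div_cancel₀ _ (hμ.1 ω).ne'
    have hxpos : ∀ ω ∈ S, ∀ c, 0 < ρ m c → 0 < dir σ ρ ω c := by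
      intro ω hω c hc
      simp only [hS, Finset.mem_filter, Finset.mem_univ, true_and] at hω
      refine lt_of_lt_of_le (mul_pos hω hc) ?_
      exact Finset.single_le_sum (f := fun m => σ ω m * ρ m c)
        (fun m _ => mul_nonneg ((h.1 ω).1 m) ((h.2.1 m).1 c)) (Finset.mem_univ m)
    have hObd : ∀ a' c, Ob μ₀ uR d a' c =
        ((if a' = b then 1 else 0) - (if a' = a then 1 else 0)) *
          ∑ ω, δ ω * (uR (a', ω) - uR (c, ω)) := by
      intro a' c
      unfold Ob
      rw [Finset.mul_sum]
      refine Finset.sum_congr rfl (fun ω _ => ?_)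
      simp only [hd]
      rw [← mul_assoc, hμd]
      ring
    have htight : ∀ a' c, 0 < ρ m a' → R a' = R a → Ob μ₀ uR (dir σ ρ) a' c = 0 → c ∈ B := by
      intro a' c hpos hRa' h0
      rw [dir_Ob] at h0
      have := (Finset.sum_eq_zero_iff_of_nonneg (fun m _ => dir_term_nonneg h a' c m)).1 h0 m
        (Finset.mem_univ m)
      rcases mul_eq_zero.1 this with h1 | h1
      · linarith
      · simp only [hB, Finset.mem_filter, Finset.mem_univ, true_and]
        simp only [hR] at hRa' ⊢
        linarith
    have hpair : ∀ c ∈ B, ∀ c' ∈ B, ∑ ω, δ ω * (uR (c, ω) - uR (c', ω)) = 0 := by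
      intro c hc c' hc'
      have h1 := hδB c hc
      have h2 := hδB c' hc'
      simp only [mul_sub, Finset.sum_sub_distrib] at h1 h2 ⊢
      linarith
    have haB : a ∈ B := by simp [hB]
    have hbB : b ∈ B := by simp [hB, hRab]
    have hV := perturb μ₀ uS uR (dir σ ρ) d (dir_isMsg h.1 h.2.1) (dir_Ob_nonneg h) hopt
      (by
        intro ω
        simp only [hd, ← Finset.mul_sum, Finset.sum_sub_distrib]
        simp)
      (by
        intro ω c hc
        by_cases hω : ω ∈ S
        · have hca : c ≠ a := by
            rintro rfl
            exact (hxpos ω hω c ha).ne' hc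
          have hcb : c ≠ b := by
            rintro rfl
            exact (hxpos ω hω c hb).ne' hc
          simp [hd, hca, hcb]
        · simp [hd, hδS ω hω])
      (by
        intro a' c h0
        rw [hObd]
        by_cases hca : a' = a
        · subst hca
          rw [hpair a' haB c (htight a' c ha rfl h0)]; simp
        · by_cases hcb : a' = b
          · subst hcb
            rw [hpair a' hbB c (htight a' c hb hRab h0)]; simp
          · simp [hca, hcb])
    have hVd : Vd μ₀ uS d = ∑ ω, δ ω * (uS (b, ω) - uS (a, ω)) := by
      unfold Vd
      refine Finset.sum_congr rfl (fun ω _ => ?_)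
      have : ∀ c ∈ Finset.univ, μ₀ ω * d ω c * uS (c, ω) = δ ω *
          ((if c = b then uS (c, ω) else 0) - (if c = a then uS (c, ω) else 0)) := by
        intro c _
        simp only [hd]
        rw [← mul_assoc, hμd]
        split_ifs <;> ring
      rw [Finset.sum_congr rfl this, ← Finset.mul_sum, Finset.sum_sub_distrib]
      simp
    rw [hVd] at hV
    exact hV
  have h1 := key δ hδS hδB
  have h2 := key (fun ω => - δ ω) (fun ω hω => by simp [hδS ω hω]) (fun c hc => by
    simp only [neg_mul, Finset.sum_neg_distrib, hδB c hc, neg_zero])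
  simp only [neg_mul, Finset.sum_neg_distrib] at h2
  exact hδ (le_antisymm h1 (by linarith))

end Helpers

section Helpers2

open Filter Topology

lemma isCompact_strat (X Y : Type) [Fintype X] [Fintype Y] :
    IsCompact {σ : X → Y → ℝ | ∀ x, IsDist (σ x)} := by
  have : {σ : X → Y → ℝ | ∀ x, IsDist (σ x)} = Set.pi Set.univ (fun _ => stdSimplex ℝ Y) := by
    ext σ
    simp [IsDist, stdSimplex, Set.mem_pi]
  rw [this]
  exact isCompact_univ_pi (fun _ => isCompact_stdSimplex ℝ Y)

lemma continuous_U (μ₀ : Ω → ℝ) (u : A × Ω → ℝ) {Z : Type} [TopologicalSpace Z]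
    {f : Z → Ω → M → ℝ} {g : Z → M → A → ℝ} (hf : Continuous f) (hg : Continuous g) :
    Continuous (fun z => U μ₀ u (f z) (g z)) := by
  unfold U
  fun_prop

lemma isClosed_RBR (μ₀ : Ω → ℝ) (u : A × Ω → ℝ) :
    IsClosed {p : (Ω → M → ℝ) × (M → A → ℝ) | RBR μ₀ u p.1 p.2} := by
  unfold RBR
  simp only [Set.ofPred_forall]
  exact isClosed_iInter fun ρ' => isClosed_iInter fun _ =>
    isClosed_le (continuous_U _ _ continuous_fst continuous_const)
      (continuous_U _ _ continuous_fst continuous_snd)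

lemma isClosed_SBR (μ₀ : Ω → ℝ) (u : A × Ω → ℝ) :
    IsClosed {p : (Ω → M → ℝ) × (M → A → ℝ) | SBR μ₀ u p.1 p.2} := by
  unfold SBR
  simp only [Set.ofPred_forall]
  exact isClosed_iInter fun ρ' => isClosed_iInter fun _ =>
    isClosed_le (continuous_U _ _ continuous_const continuous_snd)
      (continuous_U _ _ continuous_fst continuous_snd)

lemma isClosed_part :
    IsClosed {p : (Ω → M → ℝ) × (M → A → ℝ) | Partitional p.1} := by
  unfold Partitional
  simp only [Set.ofPred_forall, Set.ofPred_exists]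
  exact isClosed_iInter fun ω => isClosed_iUnion_of_finite fun m =>
    isClosed_eq (by fun_prop) continuous_const

lemma isCompact_pers (μ₀ : Ω → ℝ) (uR : A × Ω → ℝ) :
    IsCompact {p : (Ω → M → ℝ) × (M → A → ℝ) | PersProfile μ₀ uR p.1 p.2} := by
  have := ((isCompact_strat Ω M).prod (isCompact_strat M A)).inter_right (isClosed_RBR μ₀ uR)
  convert this using 1
  ext p
  simp [PersProfile, IsMsg, IsAct, and_assoc]

/-- Attainment of a supremum of Sender payoffs. -/
lemma sup_aux (μ₀ : Ω → ℝ) (uS uR : A × Ω → ℝ) (C : (Ω → M → ℝ) → (M → A → ℝ) → Prop)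
    (hC : IsClosed {p : (Ω → M → ℝ) × (M → A → ℝ) | C p.1 p.2})
    (hne : ∃ σ ρ, C σ ρ ∧ PersProfile μ₀ uR σ ρ)
    (T : Set ℝ)
    (hT : T = {x | ∃ (σ : Ω → M → ℝ) (ρ : M → A → ℝ),
      (C σ ρ ∧ PersProfile μ₀ uR σ ρ) ∧ x = U μ₀ uS σ ρ}) :
    (∃ σ ρ, C σ ρ ∧ PersProfile μ₀ uR σ ρ ∧ U μ₀ uS σ ρ = sSup T) ∧
    ∀ σ ρ, C σ ρ → PersProfile μ₀ uR σ ρ → U μ₀ uS σ ρ ≤ sSup T := by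
  have hK := (isCompact_pers (M := M) μ₀ uR).inter_right hC
  have hI : T = (fun p : (Ω → M → ℝ) × (M → A → ℝ) => U μ₀ uS p.1 p.2) ''
      ({p | PersProfile μ₀ uR p.1 p.2} ∩ {p | C p.1 p.2}) := by
    rw [hT]
    ext x
    constructor
    · rintro ⟨σ, ρ, ⟨h1, h2⟩, rfl⟩
      exact ⟨(σ, ρ), ⟨h2, h1⟩, rfl⟩
    · rintro ⟨⟨σ, ρ⟩, ⟨h2, h1⟩, rfl⟩
      exact ⟨σ, ρ, ⟨h1, h2⟩, rfl⟩
  have hcT : IsCompact T := by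
    rw [hI]
    exact hK.image (continuous_U _ _ continuous_fst continuous_snd)
  have hneT : T.Nonempty := by
    obtain ⟨σ, ρ, h⟩ := hne
    rw [hT]
    exact ⟨_, σ, ρ, h, rfl⟩
  constructor
  · have := hcT.sSup_mem hneT
    rw [hT] at this
    obtain ⟨σ, ρ, ⟨h1, h2⟩, h3⟩ := this
    refine ⟨σ, ρ, h1, h2, ?_⟩
    rw [hT]
    exact h3.symm
  · intro σ ρ h1 h2
    apply le_csSup hcT.bddAbove
    rw [hT]
    exact ⟨σ, ρ, ⟨h1, h2⟩, rfl⟩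

open Classical in
/-- Cheap-talk equilibrium from a deterministic recommendation. -/
lemma det_CTEq (μ₀ : Ω → ℝ) (hμ : IsPrior μ₀) (uS uR : A × Ω → ℝ) [Nonempty Ω] (i : A → M)
    (hi : Function.Injective i) (f : Ω → A)
    (hO : ∀ ω c, 0 ≤ Ob μ₀ uR (fun ω => Pi.single (f ω) 1) (f ω) c)
    (hS : ∀ ω ω', uS (f ω', ω) ≤ uS (f ω, ω)) :
    ∃ (σ : Ω → M → ℝ) (ρ : M → A → ℝ), Partitional σ ∧ CTEq μ₀ uS uR σ ρ ∧
      U μ₀ uS σ ρ = Vd μ₀ uS (fun ω => Pi.single (f ω) 1) := by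
  obtain ⟨ω₀⟩ := ‹Nonempty Ω›
  set h : M → Ω := fun m => if hm : ∃ ω, i (f ω) = m then hm.choose else ω₀ with hh
  have hhi : ∀ ω, f (h (i (f ω))) = f ω := by
    intro ω
    have hm : ∃ ω', i (f ω') = i (f ω) := ⟨ω, rfl⟩
    simp only [hh, dif_pos hm]
    exact hi hm.choose_spec
  set σ : Ω → M → ℝ := fun ω => Pi.single (i (f ω)) 1 with hσ
  set ρ : M → A → ℝ := fun m => Pi.single (f (h m)) 1 with hρ
  have hσm : IsMsg σ := fun ω => isDist_single _
  have hρa : IsAct ρ := fun m => isDist_single _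
  have hsumρ : ∀ m ω, ∑ a, ρ m a * uS (a, ω) = uS (f (h m), ω) := by
    intro m ω
    simp [hρ, Pi.single_apply]
  refine ⟨σ, ρ, fun ω => ⟨i (f ω), by simp [hσ]⟩, ⟨hσm, hρa, ?_, ?_⟩, ?_⟩
  · rw [SBR_iff _ hμ _ _ _ hσm]
    intro ω m hm k
    have : m = i (f ω) := by
      by_contra hne
      simp [hσ, hne] at hm
    subst this
    rw [hsumρ, hsumρ, hhi]
    exact hS ω _
  · rw [RBR_iff _ _ _ _ hρa]
    intro m a ha c
    have : a = f (h m) := by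
      by_contra hne
      simp [hρ, hne] at ha
    subst this
    by_cases hm : ∃ ω, i (f ω) = m
    · obtain ⟨ω, rfl⟩ := hm
      rw [hhi]
      have := hO ω c
      unfold Ob at this
      simp only [mul_sub, Finset.sum_sub_distrib] at this
      have e : ∀ ω', σ ω' (i (f ω)) = (Pi.single (f ω') 1 : A → ℝ) (f ω) := by
        intro ω'
        simp [hσ, Pi.single_apply, hi.eq_iff]
      simp only [e]
      linarith
    · have e : ∀ ω', σ ω' m = 0 := by
        intro ω'
        simp only [hσ, Pi.single_apply]
        rw [if_neg]
        intro he
        exact hm ⟨ω', he.symm⟩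
      simp [e]
  · rw [U_eq_S]
    unfold Vd
    refine Finset.sum_congr rfl (fun ω _ => ?_)
    simp only [hsumρ]
    simp [hσ, Pi.single_apply, hhi]

lemma exists_babbling (μ₀ : Ω → ℝ) (hμ : IsPrior μ₀) (uS uR : A × Ω → ℝ) [Nonempty Ω]
    [Nonempty A] (i : A → M) (hi : Function.Injective i) :
    ∃ (σ : Ω → M → ℝ) (ρ : M → A → ℝ), Partitional σ ∧ CTEq μ₀ uS uR σ ρ := by
  obtain ⟨a, ha⟩ := Finite.exists_max (fun a => ∑ ω, μ₀ ω * uR (a, ω))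
  obtain ⟨σ, ρ, h1, h2, _⟩ := det_CTEq μ₀ hμ uS uR i hi (fun _ => a) (by
    intro ω c
    have := ha c
    simp only [Ob, Pi.single_eq_same, mul_one, mul_sub, Finset.sum_sub_distrib]
    linarith) (fun _ _ => le_rfl)
  exact ⟨σ, ρ, h1, h2⟩

open Classical in
/-- If on-path actions are determined by the state, the direct mechanism is deterministic. -/
lemma dir_single {σ : Ω → M → ℝ} {ρ : M → A → ℝ} (hσ : IsMsg σ) (f : Ω → A)
    (h : ∀ ω m, 0 < σ ω m → ρ m = Pi.single (f ω) 1) :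
    dir σ ρ = fun ω => Pi.single (f ω) 1 := by
  funext ω a
  unfold dir
  have : ∀ m ∈ Finset.univ, σ ω m * ρ m a = σ ω m * (Pi.single (f ω) 1 : A → ℝ) a := by
    intro m _
    rcases ((hσ ω).1 m).eq_or_lt with h0 | h0
    · rw [← h0]; simp
    · rw [h ω m h0]
  rw [Finset.sum_congr rfl this, ← Finset.sum_mul, (hσ ω).2, one_mul]

open Classical in
lemma main_iff [Nonempty Ω] [Nonempty A]
    (hM : max (Fintype.card Ω) (Fintype.card A) < Fintype.card M)
    (μ₀ : Ω → ℝ) (hμ : IsPrior μ₀) (uS uR : A × Ω → ℝ) (hG : Good μ₀ uS uR) :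
    ctPayoff (M := M) μ₀ uS uR < persPayoff (M := M) μ₀ uS uR ↔
      partPersPayoff (M := M) μ₀ uS uR < persPayoff (M := M) μ₀ uS uR := by
  obtain ⟨⟨i, hi⟩⟩ : Nonempty (A ↪ M) :=
    Function.Embedding.nonempty_of_card_le ((le_max_right _ _).trans hM.le)
  obtain ⟨σb, ρb, hbp, hbc⟩ := exists_babbling μ₀ hμ uS uR i hi
  have hbpers : PersProfile μ₀ uR σb ρb := ⟨hbc.1, hbc.2.1, hbc.2.2.2⟩
  obtain ⟨-, hpU⟩ := sup_aux μ₀ uS uR (fun (_ : Ω → M → ℝ) (_ : M → A → ℝ) => True)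
    (by simp) ⟨σb, ρb, trivial, hbpers⟩
    {x | ∃ (σ : Ω → M → ℝ) (ρ : M → A → ℝ), PersProfile μ₀ uR σ ρ ∧ x = U μ₀ uS σ ρ} (by simp)
  obtain ⟨hcA, hcU⟩ := sup_aux μ₀ uS uR (fun (σ : Ω → M → ℝ) (ρ : M → A → ℝ) => SBR μ₀ uS σ ρ)
    (isClosed_SBR _ _) ⟨σb, ρb, hbc.2.2.1, hbpers⟩
    {x | ∃ (σ : Ω → M → ℝ) (ρ : M → A → ℝ), CTEq μ₀ uS uR σ ρ ∧ x = U μ₀ uS σ ρ} (by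
      ext x
      simp only [Set.mem_ofPred_eq, CTEq, PersProfile]
      refine exists_congr fun σ => exists_congr fun ρ => ?_
      tauto)
  obtain ⟨hqA, hqU⟩ := sup_aux μ₀ uS uR (fun (σ : Ω → M → ℝ) (_ : M → A → ℝ) => Partitional σ)
    isClosed_part ⟨σb, ρb, hbp, hbpers⟩
    {x | ∃ (σ : Ω → M → ℝ) (ρ : M → A → ℝ),
      Partitional σ ∧ PersProfile μ₀ uR σ ρ ∧ x = U μ₀ uS σ ρ} (by
      ext x
      simp only [Set.mem_ofPred_eq, and_assoc])
  change ∀ σ ρ, True → _ → _ ≤ persPayoff (M := M) μ₀ uS uR at hpU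
  change ∃ σ ρ, _ ∧ _ ∧ _ = ctPayoff (M := M) μ₀ uS uR at hcA
  change ∀ σ ρ, _ → _ → _ ≤ ctPayoff (M := M) μ₀ uS uR at hcU
  change ∃ σ ρ, _ ∧ _ ∧ _ = partPersPayoff (M := M) μ₀ uS uR at hqA
  change ∀ σ ρ, _ → _ → _ ≤ partPersPayoff (M := M) μ₀ uS uR at hqU
  have hdirle : ∀ x' : Ω → A → ℝ, IsMsg x' → (∀ a c, 0 ≤ Ob μ₀ uR x' a c) →
      Vd μ₀ uS x' ≤ persPayoff (M := M) μ₀ uS uR := by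
    intro x' hx' hO'
    obtain ⟨σ, ρ, h1, h2, -⟩ := from_dir μ₀ uS uR i hi x' hx' hO'
    rw [← h2]
    exact hpU σ ρ trivial h1
  -- purity of optimal profiles
  have hpure : ∀ (σ : Ω → M → ℝ) (ρ : M → A → ℝ), PersProfile μ₀ uR σ ρ →
      persPayoff (M := M) μ₀ uS uR ≤ U μ₀ uS σ ρ →
      ∀ ω m, 0 < σ ω m → ∃ a, ρ m = Pi.single a 1 := by
    intro σ ρ h hopt ω m hm
    obtain ⟨a, ha⟩ := isDist_exists_pos (h.2.1 m)
    have hz : ∀ b, b ≠ a → ρ m b = 0 := by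
      intro b hb
      by_contra hne
      have hpos := lt_of_le_of_ne ((h.2.1 m).1 b) (Ne.symm hne)
      exact hb (pure_on_path μ₀ hμ uS uR hG σ ρ h (by
        intro x' hx' hO'
        rw [dir_V]
        exact (hdirle x' hx' hO').trans hopt) m ω hm b a hpos ha)
    refine ⟨a, ?_⟩
    funext b
    by_cases hb : b = a
    · subst hb
      simp [isDist_eq_one (h.2.1 m) b hz]
    · simp [hb, hz b hb]
  rw [← not_iff_not, not_lt, not_lt]
  constructor
  · intro hle
    obtain ⟨σ, ρ, hS, hP, hU⟩ := hcA
    have hopt : persPayoff (M := M) μ₀ uS uR ≤ U μ₀ uS σ ρ := by rw [hU]; exact hle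
    have hp := hpure σ ρ hP hopt
    choose mm hmm using fun ω => isDist_exists_pos (hP.1 ω)
    choose f hf using fun ω => hp ω (mm ω) (hmm ω)
    have hSB := (SBR_iff _ hμ _ _ _ hP.1).1 hS
    have hdet : ∀ ω m, 0 < σ ω m → ρ m = Pi.single (f ω) 1 := by
      intro ω m hm
      obtain ⟨a, ha⟩ := hp ω m hm
      have h1 := hSB ω m hm (mm ω)
      have h2 := hSB ω (mm ω) (hmm ω) m
      rw [ha, hf] at h1 h2
      simp [Pi.single_apply] at h1 h2
      have : a = f ω := by
        by_contra hne
        exact hG.2.1 a (f ω) hne ω (le_antisymm h2 h1)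
      rw [ha, this]
    have hd := dir_single hP.1 f hdet
    obtain ⟨σ', ρ', h1, h2, h3⟩ := from_dir μ₀ uS uR i hi (dir σ ρ) (dir_isMsg hP.1 hP.2.1)
      (dir_Ob_nonneg hP)
    have h4 := hqU σ' ρ' (h3 (fun ω => ⟨f ω, by rw [hd]; simp⟩)) h1
    rw [h2, dir_V] at h4
    exact hopt.trans h4
  · intro hle
    obtain ⟨σ, ρ, hPart, hP, hU⟩ := hqA
    have hopt : persPayoff (M := M) μ₀ uS uR ≤ U μ₀ uS σ ρ := by rw [hU]; exact hle
    have hp := hpure σ ρ hP hopt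
    choose mm hmm using hPart
    have hmm' : ∀ ω, 0 < σ ω (mm ω) := fun ω => by rw [hmm]; norm_num
    choose f hf using fun ω => hp ω (mm ω) (hmm' ω)
    have hdet : ∀ ω m, 0 < σ ω m → ρ m = Pi.single (f ω) 1 := by
      intro ω m hm
      have : m = mm ω := by
        by_contra hne
        rw [isDist_eq_zero (hP.1 ω) (hmm ω) hne] at hm
        exact lt_irrefl _ hm
      rw [this, hf]
    have hd := dir_single hP.1 f hdet
    have hO := dir_Ob_nonneg hP
    have hxm := dir_isMsg hP.1 hP.2.1
    have hV := dir_V μ₀ uS σ ρ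
    rw [hd] at hO hxm hV
    have hstrict : ∀ ω c, Ob μ₀ uR (fun ω => Pi.single (f ω) 1) (f ω) c = 0 → c = f ω := by
      intro ω c h0
      by_contra hne
      refine hG.2.2 (f ω) c (Ne.symm hne) (Finset.univ.filter (fun ω' => f ω' = f ω))
        ⟨ω, by simp⟩ ?_
      rw [← h0]
      unfold Ob
      rw [Finset.sum_filter]
      refine Finset.sum_congr rfl (fun ω' _ => ?_)
      by_cases h : f ω' = f ω
      · simp [h]
      · simp [h, Pi.single_apply, Ne.symm h]
    have hSend : ∀ ω ω', uS (f ω', ω) ≤ uS (f ω, ω) := by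
      intro ω ω'
      by_cases hff : f ω' = f ω
      · rw [hff]
      set d : Ω → A → ℝ := fun w a => if w = ω then
        (if a = f ω' then 1 else 0) - (if a = f ω then 1 else 0) else 0 with hdd
      have := perturb μ₀ uS uR (fun ω => Pi.single (f ω) 1) d hxm hO (by
        intro x' hx' hO'
        rw [hV]
        exact (hdirle x' hx' hO').trans hopt) (by
        intro w
        simp only [hdd]
        split_ifs <;> simp) (by
        intro w a hwa
        simp only [hdd]
        split_ifs with h1 h2 h3 h4
        · norm_num
        · norm_num
        · subst h1; subst h4; simp at hwa
        · norm_num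
        · norm_num) (by
        intro a c h0
        by_cases hr : ∃ w, f w = a
        · obtain ⟨w, rfl⟩ := hr
          rw [hstrict w c h0]
          simp [Ob]
        · push Not at hr
          have : ∀ w, d w a = 0 := by
            intro w
            simp [hdd, (hr ω').symm, (hr ω).symm]
          simp [Ob, this])
      have hVd : Vd μ₀ uS d = μ₀ ω * (uS (f ω', ω) - uS (f ω, ω)) := by
        unfold Vd
        rw [Finset.sum_eq_single ω]
        · simp only [hdd, if_true, mul_sub, sub_mul, Finset.sum_sub_distrib]
          simp
        · intro w _ hw
          simp [hdd, hw]
        · simp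
      rw [hVd] at this
      by_contra hcon
      push Not at hcon
      have := mul_pos (hμ.1 ω) (sub_pos.2 hcon)
      linarith
    obtain ⟨σ', ρ', -, h1, h2⟩ := det_CTEq μ₀ hμ uS uR i hi f (fun ω c => hO _ c) hSend
    have h4 := hcU σ' ρ' h1.2.2.1 ⟨h1.1, h1.2.1, h1.2.2.2⟩
    rw [h2, hV] at h4
    exact hopt.trans h4

/-- The kernel of a nonzero linear functional is null. -/
lemma ker_null {E : Type} [NormedAddCommGroup E] [NormedSpace ℝ E] [FiniteDimensional ℝ E]
    [MeasurableSpace E] [BorelSpace E] (ν : Measure E) [ν.IsAddHaarMeasure] (L : E →ₗ[ℝ] ℝ)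
    (v : E) (hv : L v ≠ 0) (T : Set E) (hT : ∀ x ∈ T, L x = 0) : ν T = 0 := by
  refine measure_mono_null (t := (LinearMap.ker L : Set E)) (fun x hx => hT x hx) ?_
  refine Measure.addHaar_submodule ν _ ?_
  intro h
  have : v ∈ LinearMap.ker L := by rw [h]; trivial
  exact hv this

lemma measurable_Bad (a b : A) (B : Finset A) (S : Finset Ω) : MeasurableSet (Bad a b B S) := by
  have : Bad a b B S = ⋃ n : ℕ, Prod.snd ''
      {q : (Metric.closedBall (0 : A → ℝ) n × Metric.sphere (0 : Ω → ℝ) 1) ×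
        ((A × Ω → ℝ) × (A × Ω → ℝ)) |
        (∀ ω, ω ∉ S → q.1.2.1 ω = 0) ∧
        (∀ c ∈ B, ∑ ω, q.1.2.1 ω * (q.2.2 (c, ω) - q.2.2 (a, ω)) = 0) ∧
        ∀ ω ∈ S, q.2.1 (b, ω) - q.2.1 (a, ω) =
          ∑ c ∈ B, q.1.1.1 c * (q.2.2 (c, ω) - q.2.2 (a, ω))} := by
    ext e
    simp only [Set.mem_iUnion]
    constructor
    · rintro ⟨l, y, hy, h1, h2, h3⟩
      obtain ⟨n, hn⟩ := exists_nat_ge ‖l‖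
      exact ⟨n, ⟨(⟨l, by simpa using hn⟩, ⟨y, by simpa using hy⟩), e⟩, ⟨h1, h2, h3⟩, rfl⟩
    · rintro ⟨n, ⟨⟨⟨l, hl⟩, ⟨y, hy⟩⟩, e'⟩, ⟨h1, h2, h3⟩, rfl⟩
      exact ⟨l, y, by simpa using hy, h1, h2, h3⟩
  rw [this]
  refine MeasurableSet.iUnion fun n => IsClosed.measurableSet ?_
  apply isClosedMap_snd_of_compactSpace
  simp only [Set.ofPred_and, Set.ofPred_forall]
  have hl : ∀ c, Continuous (fun q : (Metric.closedBall (0 : A → ℝ) n ×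
      Metric.sphere (0 : Ω → ℝ) 1) × ((A × Ω → ℝ) × (A × Ω → ℝ)) => q.1.1.1 c) := fun c =>
    (continuous_apply c).comp (continuous_subtype_val.comp (continuous_fst.comp continuous_fst))
  have hy : ∀ ω, Continuous (fun q : (Metric.closedBall (0 : A → ℝ) n ×
      Metric.sphere (0 : Ω → ℝ) 1) × ((A × Ω → ℝ) × (A × Ω → ℝ)) => q.1.2.1 ω) := fun ω =>
    (continuous_apply ω).comp (continuous_subtype_val.comp (continuous_snd.comp continuous_fst))
  refine IsClosed.inter ?_ (IsClosed.inter ?_ ?_)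
  · exact isClosed_iInter fun ω => isClosed_iInter fun _ =>
      isClosed_eq (hy ω) continuous_const
  · exact isClosed_iInter fun c => isClosed_iInter fun _ =>
      isClosed_eq (continuous_finset_sum _ fun ω _ => (hy ω).mul (by fun_prop)) continuous_const
  · exact isClosed_iInter fun c => isClosed_iInter fun _ =>
      isClosed_eq (by fun_prop) (continuous_finset_sum _ fun c _ => (hl c).mul (by fun_prop))

open Classical in
lemma Bad_null (a b : A) (hab : a ≠ b) (B : Finset A) (S : Finset Ω) :
    volume (Bad a b B S) = 0 := by
  rw [Measure.volume_eq_prod, Measure.prod_apply_symm (measurable_Bad a b B S)]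
  have : ∀ uR : A × Ω → ℝ,
      (volume : Measure (A × Ω → ℝ)) ((fun uS => (uS, uR)) ⁻¹' Bad a b B S) = 0 := by
    intro uR
    rcases Set.eq_empty_or_nonempty ((fun uS => (uS, uR)) ⁻¹' Bad a b B S) with h | h
    · rw [h]; simp
    · obtain ⟨_, -, y, hy, hyS, hyB, -⟩ := h
      simp only at hyB
      have hy0 : ∃ ω, y ω ≠ 0 := by
        by_contra hcon
        push Not at hcon
        have : y = 0 := funext hcon
        rw [this] at hy
        simp at hy
      obtain ⟨ω₀, hω₀⟩ := hy0
      let L : (A × Ω → ℝ) →ₗ[ℝ] ℝ := ∑ ω, y ω • ((LinearMap.proj (b, ω) : (A × Ω → ℝ) →ₗ[ℝ] ℝ)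
        - LinearMap.proj (a, ω))
      have hL : ∀ u, L u = ∑ ω, y ω * (u (b, ω) - u (a, ω)) := by
        intro u
        simp [L, LinearMap.sum_apply]
      refine ker_null volume L (Pi.single (b, ω₀) 1) ?_ _ ?_
      · rw [hL]
        simpa [Pi.single_apply, hab] using hω₀
      · rintro uS ⟨l, -, -, -, -, h3⟩
        simp only at h3
        rw [hL]
        have e : ∀ ω ∈ Finset.univ, y ω * (uS (b, ω) - uS (a, ω)) =
            ∑ c ∈ B, l c * (y ω * (uR (c, ω) - uR (a, ω))) := by
          intro ω _
          by_cases hω : ω ∈ S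
          · rw [h3 ω hω, Finset.mul_sum]
            exact Finset.sum_congr rfl (fun _ _ => by ring)
          · simp [hyS ω hω]
        rw [Finset.sum_congr rfl e, Finset.sum_comm]
        refine Finset.sum_eq_zero (fun c hc => ?_)
        rw [← Finset.mul_sum, hyB c hc, mul_zero]
  simp [this]

open Classical in
lemma Good_ae (μ₀ : Ω → ℝ) (hμ : IsPrior μ₀) :
    ∀ᵐ e : (A × Ω → ℝ) × (A × Ω → ℝ), Good μ₀ e.1 e.2 := by
  unfold Good
  simp only [eventually_and, eventually_all]
  refine ⟨fun a b hab B S => ?_, fun a b hab ω => ?_, fun a b hab S hS => ?_⟩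
  · rw [ae_iff]
    simpa using Bad_null a b hab B S
  · rw [Measure.volume_eq_prod]
    refine Measure.quasiMeasurePreserving_fst.ae
      (p := fun u : A × Ω → ℝ => u (a, ω) ≠ u (b, ω)) ?_
    rw [ae_iff]
    refine ker_null volume ((LinearMap.proj (a, ω) : (A × Ω → ℝ) →ₗ[ℝ] ℝ)
        - LinearMap.proj (b, ω)) (Pi.single (a, ω) 1) ?_ _ ?_
    · simp [Pi.single_apply, hab.symm]
    · intro u hu
      simp only [ne_eq, not_not, Set.mem_ofPred_eq] at hu
      simp [hu]
  · rw [Measure.volume_eq_prod]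
    refine Measure.quasiMeasurePreserving_snd.ae
      (p := fun u : A × Ω → ℝ => ∑ ω ∈ S, μ₀ ω * (u (a, ω) - u (b, ω)) ≠ 0) ?_
    rw [ae_iff]
    obtain ⟨ω₀, hω₀⟩ := hS
    refine ker_null volume (∑ ω ∈ S, μ₀ ω • ((LinearMap.proj (a, ω) : (A × Ω → ℝ) →ₗ[ℝ] ℝ)
        - LinearMap.proj (b, ω))) (Pi.single (a, ω₀) 1) ?_ _ ?_
    · simp [LinearMap.sum_apply, Pi.single_apply, hab.symm, hω₀, (hμ.1 ω₀).ne']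
    · intro u hu
      simp only [ne_eq, not_not, Set.mem_ofPred_eq] at hu
      simpa [LinearMap.sum_apply] using hu

end Helpers2

/-- Theorem 1 (Kamenica–Lin): generically, commitment is valuable iff committed
Sender values randomization. -/
theorem commitment_valuable_iff_committed_values_randomization
    (Ω A M : Type) [Fintype Ω] [Fintype A] [Fintype M]
    [Nonempty Ω] [Nonempty A]
    (hM : max (Fintype.card Ω) (Fintype.card A) < Fintype.card M)
    (μ₀ : Ω → ℝ) (hμ : IsPrior μ₀) :
    ∃ G : Set ((A × Ω → ℝ) × (A × Ω → ℝ)),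
      G ⊆ EnvCube Ω A ∧
      volume (EnvCube Ω A \ G) = 0 ∧
      ∀ e ∈ G,
        (ctPayoff (M := M) μ₀ e.1 e.2 < persPayoff (M := M) μ₀ e.1 e.2 ↔
          partPersPayoff (M := M) μ₀ e.1 e.2 < persPayoff (M := M) μ₀ e.1 e.2) := by
  refine ⟨{e | e ∈ EnvCube Ω A ∧ Good μ₀ e.1 e.2}, fun e he => he.1, ?_, fun e he =>
    main_iff hM μ₀ hμ e.1 e.2 he.2⟩
  have h := Good_ae (A := A) μ₀ hμ
  rw [ae_iff] at h
  refine measure_mono_null ?_ h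
  rintro e ⟨h1, h2⟩ h3
  exact h2 ⟨h1, h3⟩

end KL
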